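/- Let X : f = 0 be a reduced surface of degree d ≥ 3 in P³ with at most isolated singularities, whose Jacobian algebra M(f) admits a graded free resolution 0 → ⊕_{k=1}^{r} S(1−d−b_k) → ⊕_{j=1}^{q} S(1−d−c_j) → ⊕_{i=1}^{p} S(1−d−d_i) → S(1−d)^4 → S → M(f) → 0. Then the total Tjurina number of X satisfies 6τ(X) = (d−1)³ − Σ_{i=1}^{p} d_i³ + Σ_{j=1}^{q} c_j³ − Σ_{k=1}^{r} b_k³. -/

import Mathlib

open MvPolynomial

noncomputable section

abbrev S4 : Type := MvPolynomial (Fin 4) ℂ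

/-- `g` is homogeneous of integer degree `δ`: either `g = 0` or `δ ≥ 0` and `g` homogeneous. -/
def HomogZ (g : S4) (δ : ℤ) : Prop :=
  g = 0 ∨ (0 ≤ δ ∧ g.IsHomogeneous δ.toNat)

/-- The map `S^4 → S` given by the partial derivatives of `f`; its image is the Jacobian ideal. -/
def jacMap (f : S4) : (Fin 4 → S4) →ₗ[S4] S4 where
  toFun v := ∑ i, v i * pderiv i f
  map_add' a b := by simp [add_mul, Finset.sum_add_distrib]
  map_smul' c a := by simp [Finset.mul_sum, mul_assoc]

/-- The Jacobian ideal of `f`. -/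
def jacIdeal (f : S4) : Ideal S4 := Ideal.span (Set.range fun i => pderiv i f)

/-- Hilbert function of the Jacobian algebra `M(f) = S/J_f`: the dimension of its
degree `n` homogeneous component. -/
def hilb (f : S4) (n : ℕ) : ℕ :=
  Module.finrank ℂ
    ((homogeneousSubmodule (Fin 4) ℂ n) ⧸
      (Submodule.comap (homogeneousSubmodule (Fin 4) ℂ n).subtype
        (Submodule.restrictScalars ℂ (jacIdeal f))))

/-- The singular locus of the surface `X : f = 0` in `P³`. -/
def singLocus (f : S4) : Set (Projectivization ℂ (Fin 4 → ℂ)) :=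
  {P | ∀ i, eval P.rep (pderiv i f) = 0}

/-- A graded free resolution of `M(f)` of the shape (res2A). -/
structure JacRes (f : S4) {p q r : ℕ}
    (dd : Fin p → ℕ) (cc : Fin q → ℕ) (bb : Fin r → ℕ) where
  M1 : Matrix (Fin 4) (Fin p) S4
  M2 : Matrix (Fin p) (Fin q) S4
  M3 : Matrix (Fin q) (Fin r) S4
  hM1 : ∀ i a, (M1 i a).IsHomogeneous (dd a)
  hM2 : ∀ a b, HomogZ (M2 a b) ((cc b : ℤ) - (dd a : ℤ))
  hM3 : ∀ b c, HomogZ (M3 b c) ((bb c : ℤ) - (cc b : ℤ))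
  inj : Function.Injective M3.mulVecLin
  ex2 : LinearMap.range M3.mulVecLin = LinearMap.ker M2.mulVecLin
  ex1 : LinearMap.range M2.mulVecLin = LinearMap.ker M1.mulVecLin
  ex0 : LinearMap.range M1.mulVecLin = LinearMap.ker (jacMap f)

/-- Minimality of a resolution: all matrix entries lie in the irrelevant maximal ideal. -/
def JacRes.Minimal {f : S4} {p q r : ℕ} {dd : Fin p → ℕ} {cc : Fin q → ℕ} {bb : Fin r → ℕ}
    (R : JacRes f dd cc bb) : Prop :=
  (∀ i a, constantCoeff (R.M1 i a) = 0) ∧ (∀ a b, constantCoeff (R.M2 a b) = 0) ∧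
    (∀ b c, constantCoeff (R.M3 b c) = 0)


lemma hc_mul {g : S4} {k n : ℕ} (hg : g.IsHomogeneous k) (hk : k ≤ n) (w : S4) :
    homogeneousComponent n (g * w) = g * homogeneousComponent (n - k) w := by
  induction w using MvPolynomial.induction_on' with
  | monomial u c =>
    have h1 : (monomial u c : S4).IsHomogeneous u.degree := isHomogeneous_monomial c rfl
    rw [homogeneousComponent_of_mem h1, homogeneousComponent_of_mem (hg.mul h1)]
    by_cases h : n - k = u.degree
    · rw [if_pos h, if_pos (by omega)]
    · rw [if_neg h, if_neg (by omega), mul_zero]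
  | add p q hp hq => simp only [mul_add, map_add, hp, hq]

/-- graded piece of a free module -/
abbrev GP {p : ℕ} (a : Fin p → ℕ) (n : ℕ) : Type :=
  (i : Fin p) → homogeneousSubmodule (Fin 4) ℂ (n - a i)

def prj (n : ℕ) : S4 →ₗ[ℂ] homogeneousSubmodule (Fin 4) ℂ n :=
  (homogeneousComponent n).codRestrict _ (fun x => homogeneousComponent_mem n x)

def gpi {p : ℕ} (a : Fin p → ℕ) (n : ℕ) : (Fin p → S4) →ₗ[ℂ] GP a n :=
  LinearMap.pi fun i => (prj (n - a i)).comp (LinearMap.proj i)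

def gio {p : ℕ} (a : Fin p → ℕ) (n : ℕ) : GP a n →ₗ[ℂ] (Fin p → S4) :=
  LinearMap.pi fun i => (Submodule.subtype _).comp (LinearMap.proj i)

lemma prj_sub (n : ℕ) (x : homogeneousSubmodule (Fin 4) ℂ n) : prj n x.1 = x := by
  apply Subtype.ext
  exact homogeneousComponent_eq_self x.2

lemma gpi_gio {p : ℕ} (a : Fin p → ℕ) (n : ℕ) (x : GP a n) : gpi a n (gio a n x) = x := by
  funext i
  exact prj_sub _ _

lemma mat_comm {p q : ℕ} (M : Matrix (Fin p) (Fin q) S4) (d : Fin p → ℕ) (c : Fin q → ℕ)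
    (n : ℕ) (hM : ∀ a b, HomogZ (M a b) ((c b : ℤ) - (d a : ℤ))) (hc : ∀ b, c b ≤ n)
    (w : Fin q → S4) :
    M.mulVecLin (gio c n (gpi c n w)) = gio d n (gpi d n (M.mulVecLin w)) := by
  funext a
  change ∑ b, M a b * homogeneousComponent (n - c b) (w b)
    = homogeneousComponent (n - d a) (∑ b, M a b * w b)
  rw [map_sum]
  refine Finset.sum_congr rfl fun b _ => ?_
  rcases hM a b with h | ⟨h0, h⟩
  · simp [h]
  · have := hc b
    rw [hc_mul h (by omega)]
    congr 3
    omega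

lemma jac_comm (f : S4) (e n : ℕ) (he : e ≤ n) (hf : ∀ i, (pderiv i f).IsHomogeneous e)
    (w : Fin 4 → S4) :
    jacMap f (gio (fun _ => e) n (gpi (fun _ => e) n w)) = (prj n (jacMap f w)).1 := by
  change ∑ b, homogeneousComponent (n - e) (w b) * pderiv b f
    = homogeneousComponent n (∑ b, w b * pderiv b f)
  rw [map_sum]
  refine Finset.sum_congr rfl fun b _ => ?_
  rw [mul_comm, mul_comm (w b), hc_mul (hf b) he]

lemma jac_range (f : S4) (x : S4) : x ∈ jacIdeal f ↔ ∃ v, jacMap f v = x := by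
  rw [jacIdeal, Ideal.mem_span_range_iff_exists_fun]
  rfl

/-- abstract exactness transfer -/
lemma ex_transfer {A B C A' B' C' : Type*} [AddCommGroup A] [AddCommGroup B] [AddCommGroup C]
    [AddCommGroup A'] [AddCommGroup B'] [AddCommGroup C']
    [Module ℂ A] [Module ℂ B] [Module ℂ C] [Module ℂ A'] [Module ℂ B'] [Module ℂ C']
    (F : A → B) (G : B → C) (hFG : ∀ y, G y = 0 ↔ ∃ x, F x = y)
    (πA : A →ₗ[ℂ] A') (ιA : A' →ₗ[ℂ] A) (πB : B →ₗ[ℂ] B') (ιB : B' →ₗ[ℂ] B)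
    (πC : C →ₗ[ℂ] C') (ιC : C' →ₗ[ℂ] C)
    (hB : ∀ x, πB (ιB x) = x) (hC : ∀ x, πC (ιC x) = x)
    (cF : ∀ x, F (ιA (πA x)) = ιB (πB (F x)))
    (cG : ∀ x, G (ιB (πB x)) = ιC (πC (G x)))
    (T : A' →ₗ[ℂ] B') (U : B' →ₗ[ℂ] C')
    (hT : ∀ x, T x = πB (F (ιA x))) (hU : ∀ x, U x = πC (G (ιB x))) :
    LinearMap.range T = LinearMap.ker U := by
  ext y
  rw [LinearMap.mem_range, LinearMap.mem_ker, hU]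
  constructor
  · rintro ⟨x, rfl⟩
    rw [hT, cG, hC, (hFG _).2 ⟨_, rfl⟩, map_zero]
  · intro h
    have h1 : G (ιB y) = 0 := by
      have := cG (ιB y)
      rw [hB, h, map_zero] at this
      exact this
    obtain ⟨x, hx⟩ := (hFG _).1 h1
    refine ⟨πA x, ?_⟩
    rw [hT, cF, hB, hx, hB]

lemma dim_alt {U0 U1 U2 U3 U4 : Type*} [AddCommGroup U0] [AddCommGroup U1] [AddCommGroup U2]
    [AddCommGroup U3] [AddCommGroup U4] [Module ℂ U0] [Module ℂ U1] [Module ℂ U2] [Module ℂ U3]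
    [Module ℂ U4] [Module.Finite ℂ U0] [Module.Finite ℂ U1] [Module.Finite ℂ U2]
    [Module.Finite ℂ U3] [Module.Finite ℂ U4]
    (T0 : U1 →ₗ[ℂ] U0) (T1 : U2 →ₗ[ℂ] U1) (T2 : U3 →ₗ[ℂ] U2) (T3 : U4 →ₗ[ℂ] U3)
    (h0 : LinearMap.range T1 = LinearMap.ker T0) (h1 : LinearMap.range T2 = LinearMap.ker T1)
    (h2 : LinearMap.range T3 = LinearMap.ker T2) (h3 : Function.Injective T3) :
    (Module.finrank ℂ (U0 ⧸ LinearMap.range T0) : ℤ) = Module.finrank ℂ U0 - Module.finrank ℂ U1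
      + Module.finrank ℂ U2 - Module.finrank ℂ U3 + Module.finrank ℂ U4 := by
  have a := Submodule.finrank_quotient_add_finrank (LinearMap.range T0)
  have b := LinearMap.finrank_range_add_finrank_ker T0
  have c := LinearMap.finrank_range_add_finrank_ker T1
  have d := LinearMap.finrank_range_add_finrank_ker T2
  have e := LinearMap.finrank_range_of_inj h3
  rw [← h0] at b
  rw [← h1] at c
  rw [← h2] at d
  omega

instance (n : ℕ) : Module.Finite ℂ (homogeneousSubmodule (Fin 4) ℂ n) :=
  Module.Finite.iff_fg.2 (homogeneousSubmodule_fg _ _ n)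

lemma finrank_hom (n : ℕ) :
    Module.finrank ℂ (homogeneousSubmodule (Fin 4) ℂ n) = (n + 3).choose 3 := by
  have h1 : homogeneousSubmodule (Fin 4) ℂ n = restrictSupport ℂ
      (((Finset.univ : Finset (Fin 4)).finsuppAntidiag n : Finset (Fin 4 →₀ ℕ)) :
        Set (Fin 4 →₀ ℕ)) := by
    rw [homogeneousSubmodule_eq_finsupp_supported, restrictSupport]
    congr 1
    ext x
    simp [Finsupp.degree_eq_sum]
  have h2 : Module.finrank ℂ (homogeneousSubmodule (Fin 4) ℂ n) =
      ((Finset.univ : Finset (Fin 4)).finsuppAntidiag n).card := by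
    rw [h1]
    refine (Module.finrank_eq_card_basis (basisRestrictSupport ℂ _)).trans ?_
    simp
  rw [h2, Finset.card_finsuppAntidiag_nat_eq_choose]
  simp only [Finset.card_univ, Fintype.card_fin]
  rw [show 4 + n - 1 = n + 3 by omega, Nat.choose_symm_add]

lemma six_choose (m : ℕ) : (6 : ℤ) * ((m + 3).choose 3 : ℕ) = ((m : ℤ) + 2) ^ 3 - ((m : ℤ) + 2) := by
  have h := Nat.descFactorial_eq_factorial_mul_choose (m + 3) 3
  have h' : (((m + 3).descFactorial 3 : ℕ) : ℤ) = 6 * ((m + 3).choose 3 : ℕ) := by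
    rw [h]; norm_num [Nat.factorial]
  rw [← h']
  simp only [Nat.descFactorial]
  have : m + 3 - 2 = m + 1 := by omega
  have h4 : m + 3 - 1 = m + 2 := by omega
  rw [this, h4]
  push_cast
  simp
  ring

lemma six_dim {n a : ℕ} (h : a ≤ n) :
    (6 : ℤ) * (Module.finrank ℂ (homogeneousSubmodule (Fin 4) ℂ (n - a)) : ℕ)
      = ((n : ℤ) + 2 - a) ^ 3 - ((n : ℤ) + 2 - a) := by
  rw [finrank_hom, six_choose]
  push_cast [h]
  ring

lemma six_gp {p : ℕ} {a : Fin p → ℕ} {n e : ℕ} (h : ∀ i, e + a i ≤ n) :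
    (6 : ℤ) * (Module.finrank ℂ (GP (fun i => e + a i) n) : ℕ)
      = p * (((n : ℤ) + 2 - e) ^ 3 - ((n : ℤ) + 2 - e)) - 3 * ((n : ℤ) + 2 - e) ^ 2 * ∑ i, (a i : ℤ)
        + 3 * ((n : ℤ) + 2 - e) * ∑ i, (a i : ℤ) ^ 2 - ∑ i, (a i : ℤ) ^ 3 + ∑ i, (a i : ℤ) := by
  have h1 : Module.finrank ℂ (GP (fun i => e + a i) n)
      = ∑ i, Module.finrank ℂ (homogeneousSubmodule (Fin 4) ℂ (n - (e + a i))) :=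
    Module.finrank_pi_fintype ℂ
  rw [h1]
  push_cast
  rw [Finset.mul_sum]
  rw [Finset.sum_congr rfl fun i _ => six_dim (h i)]
  have h2 : (p : ℤ) * (((n : ℤ) + 2 - e) ^ 3 - ((n : ℤ) + 2 - e))
    = ∑ i : Fin p, (((n : ℤ) + 2 - e) ^ 3 - ((n : ℤ) + 2 - e)) := by simp; ring
  rw [h2, Finset.mul_sum, Finset.mul_sum, ← Finset.sum_sub_distrib, ← Finset.sum_add_distrib,
    ← Finset.sum_sub_distrib, ← Finset.sum_add_distrib]
  refine Finset.sum_congr rfl fun i _ => ?_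
  push_cast
  ring

lemma cubic_zero (a b c k : ℤ) (X : ℤ) (h : ∀ x, X ≤ x → a * x ^ 3 + b * x ^ 2 + c * x + k = 0) :
    b = 0 ∧ k = 0 := by
  have h0 := h X le_rfl
  have h1 := h (X + 1) (by omega)
  have h2 := h (X + 2) (by omega)
  have h3 := h (X + 3) (by omega)
  have ha : a = 0 := by
    have : 6 * a = 0 := by linear_combination h3 - 3 * h2 + 3 * h1 - h0
    omega
  subst ha
  have hb : b = 0 := by
    have : 2 * b = 0 := by linear_combination h2 - 2 * h1 + h0
    omega
  subst hb
  have hc : c = 0 := by linear_combination h1 - h0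
  subst hc
  exact ⟨rfl, by linear_combination h0⟩

lemma hilb_formula (f : S4) (e : ℕ) (hf : ∀ i, (pderiv i f).IsHomogeneous e)
    {p q r : ℕ} (dd : Fin p → ℕ) (cc : Fin q → ℕ) (bb : Fin r → ℕ) (R : JacRes f dd cc bb)
    (n : ℕ) (hn : e ≤ n) (h1 : ∀ i, e + dd i ≤ n) (h2 : ∀ i, e + cc i ≤ n)
    (h3 : ∀ i, e + bb i ≤ n) :
    (hilb f n : ℤ) = Module.finrank ℂ (homogeneousSubmodule (Fin 4) ℂ n)
      - Module.finrank ℂ (GP (fun _ : Fin 4 => e + 0) n) + Module.finrank ℂ (GP (fun i => e + dd i) n)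
      - Module.finrank ℂ (GP (fun i => e + cc i) n) + Module.finrank ℂ (GP (fun i => e + bb i) n) := by
  let a1 : Fin 4 → ℕ := fun _ => e + 0
  let a2 := fun i => e + dd i
  let a3 := fun i => e + cc i
  let a4 := fun i => e + bb i
  let T0 : GP a1 n →ₗ[ℂ] homogeneousSubmodule (Fin 4) ℂ n :=
    (prj n).comp (((jacMap f).restrictScalars ℂ).comp (gio a1 n))
  let T1 : GP a2 n →ₗ[ℂ] GP a1 n :=
    (gpi a1 n).comp ((R.M1.mulVecLin.restrictScalars ℂ).comp (gio a2 n))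
  let T2 : GP a3 n →ₗ[ℂ] GP a2 n :=
    (gpi a2 n).comp ((R.M2.mulVecLin.restrictScalars ℂ).comp (gio a3 n))
  let T3 : GP a4 n →ₗ[ℂ] GP a3 n :=
    (gpi a3 n).comp ((R.M3.mulVecLin.restrictScalars ℂ).comp (gio a4 n))
  have c0 := jac_comm f e n hn hf
  have c1 := mat_comm R.M1 a1 a2 n (fun i a => Or.inr
    ⟨by simp only [a1, a2]; push_cast; omega, by
      have := R.hM1 i a
      convert this using 1
      simp only [a1, a2]; push_cast; omega⟩) h1
  have c2 := mat_comm R.M2 a2 a3 n (fun i a => by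
      have := R.hM2 i a
      convert this using 1
      simp only [a2, a3]; push_cast; omega) h2
  have c3 := mat_comm R.M3 a3 a4 n (fun i a => by
      have := R.hM3 i a
      convert this using 1
      simp only [a3, a4]; push_cast; omega) h3
  have e0 : LinearMap.range T1 = LinearMap.ker T0 := by
    refine ex_transfer R.M1.mulVecLin (jacMap f) (fun y => ?_) (gpi a2 n) (gio a2 n) (gpi a1 n)
      (gio a1 n) (prj n) (Submodule.subtype _) (gpi_gio _ _) (prj_sub _) c1 c0 T1 T0
      (fun _ => rfl) (fun _ => rfl)
    rw [← LinearMap.mem_ker, ← R.ex0, LinearMap.mem_range]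
  have e1 : LinearMap.range T2 = LinearMap.ker T1 := by
    refine ex_transfer R.M2.mulVecLin R.M1.mulVecLin (fun y => ?_) (gpi a3 n) (gio a3 n) (gpi a2 n)
      (gio a2 n) (gpi a1 n) (gio a1 n) (gpi_gio _ _) (gpi_gio _ _) c2 c1 T2 T1
      (fun _ => rfl) (fun _ => rfl)
    rw [← LinearMap.mem_ker, ← R.ex1, LinearMap.mem_range]
  have e2 : LinearMap.range T3 = LinearMap.ker T2 := by
    refine ex_transfer R.M3.mulVecLin R.M2.mulVecLin (fun y => ?_) (gpi a4 n) (gio a4 n) (gpi a3 n)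
      (gio a3 n) (gpi a2 n) (gio a2 n) (gpi_gio _ _) (gpi_gio _ _) c3 c2 T3 T2
      (fun _ => rfl) (fun _ => rfl)
    rw [← LinearMap.mem_ker, ← R.ex2, LinearMap.mem_range]
  have e3 : Function.Injective T3 := by
    intro x y hxy
    have key : ∀ x, R.M3.mulVecLin (gio a4 n x) = gio a3 n (T3 x) := by
      intro x
      have := c3 (gio a4 n x)
      rw [gpi_gio] at this
      exact this
    have h : gio a4 n x = gio a4 n y := R.inj (by rw [key, key, hxy])
    rw [← gpi_gio a4 n x, h, gpi_gio]
  have := dim_alt T0 T1 T2 T3 e0 e1 e2 e3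
  rw [← this, hilb]
  have hr : Submodule.comap (homogeneousSubmodule (Fin 4) ℂ n).subtype
        (Submodule.restrictScalars ℂ (jacIdeal f)) = LinearMap.range T0 := by
    ext x
    rw [Submodule.mem_comap, Submodule.restrictScalars_mem, jac_range, LinearMap.mem_range]
    constructor
    · rintro ⟨v, hv⟩
      refine ⟨gpi a1 n v, ?_⟩
      change prj n (jacMap f (gio a1 n (gpi a1 n v))) = x
      have := c0 v
      rw [hv] at this
      erw [this]
      rw [prj_sub]
      exact prj_sub n x
    · rintro ⟨v, rfl⟩
      refine ⟨gio a1 n v, ?_⟩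
      have := c0 (gio a1 n v)
      erw [gpi_gio] at this
      exact this
  rw [hr]

lemma eval_smul_hom {g : S4} {k : ℕ} (hg : g.IsHomogeneous k) (a : ℂ) (v : Fin 4 → ℂ) :
    eval (a • v) g = a ^ k * eval v g := by
  rw [eval_eq, eval_eq, Finset.mul_sum]
  refine Finset.sum_congr rfl fun s hs => ?_
  have hd : ∑ i, s i = k := by
    rw [← Finsupp.degree_eq_sum]
    by_contra h
    exact (mem_support_iff.1 hs) (hg.coeff_eq_zero h)
  rw [← hd, ← Finset.prod_pow_eq_pow_sum]
  have h2 : ∀ x : Fin 4 → ℂ, ∏ i ∈ s.support, x i ^ s i = ∏ i, x i ^ s i := fun x =>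
    Finset.prod_subset (Finset.subset_univ _) (fun i _ hi => by
      simp [Finsupp.notMem_support_iff.1 hi])
  rw [h2, h2]
  simp only [Pi.smul_apply, smul_eq_mul, mul_pow, Finset.prod_mul_distrib]
  ring

def linf (u : Fin 4 → ℂ) : S4 := ∑ i, C (u i) * X i

lemma linf_hom (u : Fin 4 → ℂ) : (linf u).IsHomogeneous 1 :=
  IsHomogeneous.sum _ _ _ fun _ _ => isHomogeneous_C_mul_X _ _

lemma eval_linf (u v : Fin 4 → ℂ) : eval v (linf u) = ∑ i, u i * v i := by
  simp [linf]

lemma exists_linf (s : Set (Projectivization ℂ (Fin 4 → ℂ))) (hs : s.Finite) :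
    ∃ u : Fin 4 → ℂ, ∀ P ∈ s, eval P.rep (linf u) ≠ 0 := by
  have hne : ∏ P ∈ hs.toFinset, linf P.rep ≠ 0 := by
    rw [Finset.prod_ne_zero_iff]
    intro P _ h0
    apply P.rep_nonzero
    funext i
    have := congrArg (eval (Pi.single i (1 : ℂ))) h0
    rw [eval_linf] at this
    simpa [Pi.single_apply] using this
  obtain ⟨u, hu⟩ : ∃ u, eval u (∏ P ∈ hs.toFinset, linf P.rep) ≠ 0 := by
    by_contra! h
    exact hne (MvPolynomial.funext fun x => by rw [h x, map_zero])
  rw [map_prod, Finset.prod_ne_zero_iff] at hu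
  refine ⟨u, fun P hP => ?_⟩
  have := hu P (hs.mem_toFinset.2 hP)
  rw [eval_linf] at this ⊢
  simpa only [mul_comm] using this

lemma exists_pow_le (f : S4) (e : ℕ) (hf : ∀ i, (pderiv i f).IsHomogeneous e)
    (hiso : (singLocus f).Finite) :
    ∃ (u : Fin 4 → ℂ) (N : ℕ), idealOfVars (Fin 4) ℂ ^ N ≤ jacIdeal f ⊔ Ideal.span {linf u} := by
  obtain ⟨u, hu⟩ := exists_linf _ hiso
  refine ⟨u, Ideal.exists_pow_le_of_le_radical_of_fg ?_ (idealOfVars_fg _ _)⟩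
  have hrad := vanishingIdeal_zeroLocus_eq_radical (k := ℂ) (K := ℂ) (jacIdeal f ⊔ Ideal.span {linf u})
  rw [← hrad, idealOfVars, Ideal.span_le]
  rintro _ ⟨i, rfl⟩
  rw [SetLike.mem_coe]
  rw [mem_vanishingIdeal_iff]
  intro v hv
  rw [mem_zeroLocus_iff] at hv
  have hv0 : v = 0 := by
    by_contra hv0
    obtain ⟨a, ha⟩ := Projectivization.exists_smul_eq_mk_rep ℂ v hv0
    have ha' : (Projectivization.mk ℂ v hv0).rep = (a : ℂ) • v := ha.symm
    refine hu (Projectivization.mk ℂ v hv0) (fun j => ?_) ?_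
    · rw [ha', eval_smul_hom (hf j)]
      have := hv (pderiv j f) (Ideal.mem_sup_left (Ideal.subset_span ⟨j, rfl⟩))
      rw [MvPolynomial.aeval_eq_eval] at this
      erw [this, mul_zero]
    · rw [ha', eval_smul_hom (linf_hom u)]
      have := hv (linf u) (Ideal.mem_sup_right (Ideal.subset_span rfl))
      rw [MvPolynomial.aeval_eq_eval] at this
      erw [this, mul_zero]
  simp [hv0]

lemma hilb_step (f : S4) (e : ℕ) (hf : ∀ i, (pderiv i f).IsHomogeneous e) (u : Fin 4 → ℂ) (N : ℕ)
    (hN : idealOfVars (Fin 4) ℂ ^ N ≤ jacIdeal f ⊔ Ideal.span {linf u})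
    (n : ℕ) (hn : N ≤ n) (he : e ≤ n) : hilb f (n + 1) ≤ hilb f n := by
  let K : ∀ n, Submodule ℂ (homogeneousSubmodule (Fin 4) ℂ n) := fun n =>
    Submodule.comap (homogeneousSubmodule (Fin 4) ℂ n).subtype
        (Submodule.restrictScalars ℂ (jacIdeal f))
  let m : homogeneousSubmodule (Fin 4) ℂ n →ₗ[ℂ] homogeneousSubmodule (Fin 4) ℂ (n + 1) :=
    ((LinearMap.mulLeft ℂ (linf u)).comp (Submodule.subtype _)).codRestrict _ (fun x => by
      have := (linf_hom u).mul x.2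
      rw [add_comm] at this
      exact this)
  have hm : K n ≤ (K (n + 1)).comap m := by
    intro x hx
    change linf u * x.1 ∈ jacIdeal f
    exact Ideal.mul_mem_left _ (linf u) hx
  let Φ : (homogeneousSubmodule (Fin 4) ℂ n ⧸ K n) →ₗ[ℂ]
    (homogeneousSubmodule (Fin 4) ℂ (n + 1) ⧸ K (n + 1)) := Submodule.mapQ _ _ m hm
  have hsurj : Function.Surjective Φ := by
    intro y
    obtain ⟨y, rfl⟩ := Submodule.mkQ_surjective _ y
    have hy : y.1 ∈ jacIdeal f ⊔ Ideal.span {linf u} := by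
      apply hN
      rw [mem_pow_idealOfVars_iff]
      intro x hx
      by_contra h
      exact (mem_support_iff.1 hx) (IsHomogeneous.coeff_eq_zero y.2 (by omega))
    obtain ⟨j, hj, z, hz, hjz⟩ := Submodule.mem_sup.1 hy
    obtain ⟨w, rfl⟩ := Ideal.mem_span_singleton'.1 hz
    obtain ⟨v, hv⟩ := (jac_range f j).1 hj
    refine ⟨Submodule.mkQ _ (prj n w), ?_⟩
    change Submodule.Quotient.mk (m (prj n w)) = Submodule.Quotient.mk y
    rw [eq_comm, Submodule.Quotient.eq]
    change y.1 - linf u * homogeneousComponent n w ∈ jacIdeal f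
    have h1 : y.1 = homogeneousComponent (n + 1) y.1 := (homogeneousComponent_eq_self y.2).symm
    rw [← hjz, map_add, mul_comm w, hc_mul (linf_hom u) (by omega), mul_comm (linf u) w, hjz] at h1
    rw [h1, Nat.add_sub_cancel, add_sub_cancel_right, jac_range]
    exact ⟨_, (jac_comm f e (n + 1) (by omega) hf v).trans (by rw [hv]; rfl)⟩
  exact LinearMap.finrank_le_finrank_of_surjective hsurj

lemma ev_const (H : ℕ → ℕ) (N : ℕ) (h : ∀ n, N ≤ n → H (n + 1) ≤ H n) :
    ∃ τ M, ∀ k, M ≤ k → H k = τ := by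
  have ha : ∀ a b, N ≤ a → a ≤ b → H b ≤ H a := by
    intro a b hNa hab
    induction b, hab using Nat.le_induction with
    | base => exact le_rfl
    | succ b hab ih => exact (h b (by omega)).trans ih
  classical
  have hex : ∃ t, ∃ k, N ≤ k ∧ H k = t := ⟨_, N, le_rfl, rfl⟩
  obtain ⟨M, hM, hMt⟩ := Nat.find_spec hex
  refine ⟨_, M, fun k hk => le_antisymm (ha M k hM hk) ?_⟩
  rw [hMt]
  exact Nat.find_min' hex ⟨k, by omega, rfl⟩

/-- Theorem 1 (2), second part: if `X` has at most isolated singularities,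
then the Hilbert function of `M(f)` is eventually constant equal to the total Tjurina number
`τ(X)`, and `6 τ(X) = (d−1)³ − Σ dᵢ³ + Σ cⱼ³ − Σ bₖ³`. -/
theorem stmt2 (f : S4) (d : ℕ) (hd : 3 ≤ d) (hhom : f.IsHomogeneous d) (hred : Squarefree f)
    (hiso : (singLocus f).Finite)
    (p q r : ℕ) (hp : 3 ≤ p)
    (dd : Fin p → ℕ) (cc : Fin q → ℕ) (bb : Fin r → ℕ)
    (hddpos : ∀ i, 0 < dd i) (hccpos : ∀ j, 0 < cc j) (hbbpos : ∀ k, 0 < bb k)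
    (hddmono : Monotone dd) (hccmono : Monotone cc) (hbbmono : Monotone bb)
    (R : JacRes f dd cc bb) :
    ∃ (τ : ℕ) (N : ℕ), (∀ k, N ≤ k → hilb f k = τ) ∧
      6 * (τ : ℤ) = ((d : ℤ) - 1) ^ 3 - (∑ i, (dd i : ℤ) ^ 3) + (∑ j, (cc j : ℤ) ^ 3)
        - (∑ k, (bb k : ℤ) ^ 3) := by
  have hf : ∀ i, (pderiv i f).IsHomogeneous (d - 1) := fun i => hhom.pderiv
  obtain ⟨u, N, hN⟩ := exists_pow_le f (d - 1) hf hiso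
  obtain ⟨τ, M, hM⟩ := ev_const (hilb f) (N + (d - 1)) (fun n hn =>
    hilb_step f (d - 1) hf u N hN n (by omega) (by omega))
  refine ⟨τ, M, hM, ?_⟩
  obtain ⟨e, rfl⟩ : ∃ e, d = e + 1 := ⟨d - 1, by omega⟩
  simp only [Nat.add_sub_cancel] at hf
  set B : ℕ := M + e + ∑ i, dd i + ∑ i, cc i + ∑ i, bb i with hB
  have s1 : ∀ i, dd i ≤ ∑ i, dd i := fun i =>
    Finset.single_le_sum (fun _ _ => Nat.zero_le _) (Finset.mem_univ i)
  have s2 : ∀ i, cc i ≤ ∑ i, cc i := fun i =>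
    Finset.single_le_sum (fun _ _ => Nat.zero_le _) (Finset.mem_univ i)
  have s3 : ∀ i, bb i ≤ ∑ i, bb i := fun i =>
    Finset.single_le_sum (fun _ _ => Nat.zero_le _) (Finset.mem_univ i)
  obtain ⟨hb, hk⟩ := cubic_zero ((p : ℤ) - q + r - 3)
    (3 * e - 3 * (∑ i, (dd i : ℤ) - ∑ i, (cc i : ℤ) + ∑ i, (bb i : ℤ)))
    (3 * e ^ 2 + 3 * (∑ i, (dd i : ℤ) ^ 2 - ∑ i, (cc i : ℤ) ^ 2 + ∑ i, (bb i : ℤ) ^ 2)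
      + 3 - ((p : ℤ) - q + r))
    (e ^ 3 - e - (∑ i, (dd i : ℤ) ^ 3 - ∑ i, (cc i : ℤ) ^ 3 + ∑ i, (bb i : ℤ) ^ 3)
      + (∑ i, (dd i : ℤ) - ∑ i, (cc i : ℤ) + ∑ i, (bb i : ℤ)) - 6 * τ)
    (B + 2) (fun x hx => by
      obtain ⟨n, hn⟩ : ∃ n : ℕ, x = (n : ℤ) + 2 - e := ⟨(x - 2 + e).toNat, by omega⟩
      have hnB : B ≤ n := by omega
      have t1 : ∀ i, e + dd i ≤ n := fun i => by have := s1 i; omega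
      have t2 : ∀ i, e + cc i ≤ n := fun i => by have := s2 i; omega
      have t3 : ∀ i, e + bb i ≤ n := fun i => by have := s3 i; omega
      have F := hilb_formula f e hf dd cc bb R n (by omega) t1 t2 t3
      rw [hM n (by omega)] at F
      have g0 := six_dim (n := n) (a := 0) (by omega)
      have g1 := six_gp (p := 4) (a := fun _ => 0) (n := n) (e := e) (fun _ => by omega)
      have g2 := six_gp t1
      have g3 := six_gp t2
      have g4 := six_gp t3
      simp only [Nat.sub_zero] at g0
      rw [← hn] at g1 g2 g3 g4
      have hn' : (n : ℤ) = x - 2 + e := by omega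
      rw [hn'] at g0
      simp at g1
      push_cast at g0 g1
      linear_combination -6 * F - g0 + g1 - g2 + g3 - g4)
  push_cast
  have hb2 : (e : ℤ) - (∑ i, (dd i : ℤ) - ∑ i, (cc i : ℤ) + ∑ i, (bb i : ℤ)) = 0 := by omega
  linear_combination (-1 : ℤ) * hk - hb2
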